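/- Let d ≥ 2, R ≥ 1, n ≥ 1, and let f = (f_1,…,f_R) be polynomials of degree d in n variables with real coefficients, and let F = (F_1,…,F_R) be the system of their degree-d homogeneous parts. Then there is a constant c > 0 depending only on f such that for every β ∈ ℝ^R∖{0} and all x^{(1)},…,x^{(d−1)} ∈ ℝ^n∖{0}, one of the following two alternatives holds: either ‖m^{(β·f)}(x^{(1)},…,x^{(d−1)})‖ ≥ c·‖β‖·‖x^{(1)}‖⋯‖x^{(d−1)}‖, or else there exist linear subspaces U_1,…,U_{d−1} of ℝ^n, each spanned by standard basis vectors of ℝ^n, with dim U_1 + ⋯ + dim U_{d−1} = n − σ*(F), such that for all u^{(1)} ∈ U_1,…,u^{(d−1)} ∈ U_{d−1} one has ‖J^{(β·f)}(x^{(1)},…,x^{(d−1)})·(u^{(1)},…,u^{(d−1)})‖ ≥ c·‖β‖·(‖x^{(1)}‖⋯‖x^{(d−1)}‖)·max_{1≤i≤d−1} ‖u^{(i)}‖/‖x^{(i)}‖, where (u^{(1)},…,u^{(d−1)}) is regarded as a column vector in ℝ^{(d−1)n}. -/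

import Mathlib

open MvPolynomial

noncomputable section

/-- Iterated partial derivative along a list of variable indices. -/
def iterPderiv {n : ℕ} {K : Type*} [CommSemiring K] (js : List (Fin n))
    (f : MvPolynomial (Fin n) K) : MvPolynomial (Fin n) K :=
  js.foldr (fun j g => pderiv j g) f

/-- The system of multilinear forms `m^{(f)}`. -/
def mForm {K : Type*} [CommSemiring K] (d n : ℕ) (f : MvPolynomial (Fin n) K)
    (x : Fin (d - 1) → Fin n → K) : Fin n → K :=
  fun i => ∑ j : Fin (d - 1) → Fin n,
    (∏ k, x k (j k)) * eval (0 : Fin n → K) (pderiv i (iterPderiv (List.ofFn j) f))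

/-- The `n × (d-1)n` Jacobian matrix `J^f` of `m^{(f)}`. -/
def jacMat {K : Type*} [CommSemiring K] (d n : ℕ) (f : MvPolynomial (Fin n) K)
    (x : Fin (d - 1) → Fin n → K) : Matrix (Fin n) (Fin (d - 1) × Fin n) K :=
  fun i kl => mForm d n f (Function.update x kl.1 (Pi.single kl.2 1)) i

/-- σ*(H) for a system of complex forms. -/
def sigmaStar (d n R : ℕ) (H : Fin R → MvPolynomial (Fin n) ℂ) : ℕ :=
  sSup {s : ℕ | ∃ β : Fin R → ℂ, β ≠ 0 ∧ ∃ x : Fin (d - 1) → Fin n → ℂ,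
    (∀ k, x k ≠ 0) ∧ mForm d n (∑ ρ, β ρ • H ρ) x = 0 ∧
    s = n - (jacMat d n (∑ ρ, β ρ • H ρ) x).rank}

/-- σ* for a system with real coefficients. -/
def sigmaStarR (d n R : ℕ) (F : Fin R → MvPolynomial (Fin n) ℝ) : ℕ :=
  sigmaStar d n R fun ρ => (F ρ).map (algebraMap ℝ ℂ)

/-- σ* for a system with integer coefficients. -/
def sigmaStarZ (d n R : ℕ) (F : Fin R → MvPolynomial (Fin n) ℤ) : ℕ :=
  sigmaStar d n R fun ρ => (F ρ).map (Int.castRingHom ℂ)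

/-- `‖f^{[d]}‖`. -/
def normFd (d n : ℕ) (f : MvPolynomial (Fin n) ℝ) : ℝ :=
  (d.factorial : ℝ)⁻¹ * ⨆ j : Fin d → Fin n, |eval (0 : Fin n → ℝ) (iterPderiv (List.ofFn j) f)|

/-- `N^aux_f(B)`. -/
def Naux (d n : ℕ) (g : MvPolynomial (Fin n) ℝ) (B : ℝ) : ℕ :=
  Set.ncard {x : Fin (d - 1) → Fin n → ℤ |
    (∀ k, ‖(fun i => (x k i : ℝ))‖ ≤ B) ∧
    ‖mForm d n g (fun k i => (x k i : ℝ))‖ < normFd d n g * B ^ (d - 2)}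

end

/-- The part of degree `k` of a partial derivative only depends on the part of degree `k + 1`. -/
lemma MvPolynomial.homogeneousComponent_pderiv {σ K : Type*} [CommSemiring K] (k : ℕ) (i : σ)
    (p : MvPolynomial σ K) :
    homogeneousComponent k (pderiv i p) = pderiv i (homogeneousComponent (k + 1) p) := by
  ext m
  simp only [coeff_homogeneousComponent, coeff_pderiv, map_add,
    Finsupp.degree_single, add_left_inj]
  split_ifs <;> simp

lemma homogeneousComponent_iterPderiv {n : ℕ} {K : Type*} [CommSemiring K] (js : List (Fin n))
    (k : ℕ) (p : MvPolynomial (Fin n) K) :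
    homogeneousComponent k (iterPderiv js p) =
      iterPderiv js (homogeneousComponent (k + js.length) p) := by
  induction js generalizing k with
  | nil => rfl
  | cons j js ih =>
    simp only [iterPderiv, List.foldr_cons, List.length_cons] at ih ⊢
    rw [MvPolynomial.homogeneousComponent_pderiv, ih, add_right_comm, add_assoc]

lemma map_iterPderiv {n : ℕ} {K L : Type*} [CommSemiring K] [CommSemiring L] (φ : K →+* L)
    (js : List (Fin n)) (p : MvPolynomial (Fin n) K) :
    (iterPderiv js p).map φ = iterPderiv js (p.map φ) := by
  induction js with
  | nil => rfl
  | cons j js ih =>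
    simp only [iterPderiv, List.foldr_cons] at ih ⊢
    rw [← ih, pderiv_map]

lemma iterPderiv_sum_smul {n : ℕ} {K ι : Type*} [CommSemiring K] (js : List (Fin n))
    (s : Finset ι) (β : ι → K) (f : ι → MvPolynomial (Fin n) K) :
    iterPderiv js (∑ ρ ∈ s, β ρ • f ρ) = ∑ ρ ∈ s, β ρ • iterPderiv js (f ρ) := by
  induction js with
  | nil => rfl
  | cons j js ih =>
    simp only [iterPderiv, List.foldr_cons] at ih ⊢
    rw [ih, map_sum]
    exact Finset.sum_congr rfl fun ρ _ => Derivation.map_smul _ _ _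

lemma eval_zero_homogeneousComponent_zero {n : ℕ} {K : Type*} [CommSemiring K]
    (p : MvPolynomial (Fin n) K) :
    eval (0 : Fin n → K) (homogeneousComponent 0 p) = eval 0 p := by
  rw [homogeneousComponent_zero, eval_C, eval_zero, constantCoeff_eq]

lemma mForm_homogeneousComponent {K : Type*} [CommSemiring K] {d n : ℕ} (hd : 1 ≤ d)
    (p : MvPolynomial (Fin n) K) (x : Fin (d - 1) → Fin n → K) :
    mForm d n (homogeneousComponent d p) x = mForm d n p x := by
  funext i
  refine Finset.sum_congr rfl fun j _ => ?_
  rw [← eval_zero_homogeneousComponent_zero (pderiv i (iterPderiv _ p)),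
    MvPolynomial.homogeneousComponent_pderiv, homogeneousComponent_iterPderiv, List.length_ofFn,
    show 0 + 1 + (d - 1) = d by omega]

lemma mForm_sum_smul {K ι : Type*} [CommSemiring K] {d n : ℕ} (s : Finset ι) (β : ι → K)
    (f : ι → MvPolynomial (Fin n) K) (x : Fin (d - 1) → Fin n → K) :
    mForm d n (∑ ρ ∈ s, β ρ • f ρ) x = ∑ ρ ∈ s, β ρ • mForm d n (f ρ) x := by
  funext i
  simp only [mForm, iterPderiv_sum_smul, map_sum, Derivation.map_smul, Finset.sum_apply, Pi.smul_apply,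
    smul_eq_mul, smul_eval, Finset.mul_sum]
  rw [Finset.sum_comm]
  exact Finset.sum_congr rfl fun ρ _ => Finset.sum_congr rfl fun j _ => by ring

lemma mForm_map {K L : Type*} [CommSemiring K] [CommSemiring L] (φ : K →+* L) {d n : ℕ}
    (p : MvPolynomial (Fin n) K) (x : Fin (d - 1) → Fin n → K) (i : Fin n) :
    mForm d n (p.map φ) (fun k l => φ (x k l)) i = φ (mForm d n p x i) := by
  simp only [mForm, ← map_iterPderiv, pderiv_map, map_sum, map_mul, map_prod]
  refine Finset.sum_congr rfl fun j _ => ?_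
  congr 1
  simp only [eval_zero, constantCoeff_map]

lemma mForm_smul {K : Type*} [CommSemiring K] {d n : ℕ} (p : MvPolynomial (Fin n) K)
    (r : Fin (d - 1) → K) (x : Fin (d - 1) → Fin n → K) :
    mForm d n p (fun k => r k • x k) = (∏ k, r k) • mForm d n p x := by
  funext i
  simp only [mForm, Pi.smul_apply, smul_eq_mul, Finset.prod_mul_distrib, Finset.mul_sum, mul_assoc]

lemma jacMat_map {K L : Type*} [CommSemiring K] [CommSemiring L] (φ : K →+* L) {d n : ℕ}
    (p : MvPolynomial (Fin n) K) (x : Fin (d - 1) → Fin n → K) :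
    jacMat d n (p.map φ) (fun k l => φ (x k l)) = (jacMat d n p x).map φ := by
  ext i kl
  simp only [jacMat, Matrix.map_apply, ← mForm_map]
  congr 1
  funext k l
  rcases eq_or_ne k kl.1 with rfl | h
  · rcases eq_or_ne l kl.2 with rfl | h' <;> simp [*]
  · simp [h]

lemma jacMat_homogeneousComponent {K : Type*} [CommSemiring K] {d n : ℕ} (hd : 1 ≤ d)
    (p : MvPolynomial (Fin n) K) (x : Fin (d - 1) → Fin n → K) :
    jacMat d n (homogeneousComponent d p) x = jacMat d n p x := by
  ext i kl
  simp only [jacMat, mForm_homogeneousComponent hd]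

lemma jacMat_smul_mulVec {K : Type*} [CommSemiring K] {d n : ℕ} (p : MvPolynomial (Fin n) K)
    (r : Fin (d - 1) → K) (x v : Fin (d - 1) → Fin n → K) :
    (jacMat d n p (fun k => r k • x k)).mulVec (fun kl => r kl.1 * v kl.1 kl.2) =
      (∏ k, r k) • (jacMat d n p x).mulVec (fun kl => v kl.1 kl.2) := by
  funext i
  simp only [Matrix.mulVec, dotProduct, Pi.smul_apply, smul_eq_mul, Finset.mul_sum]
  refine Finset.sum_congr rfl fun kl _ => ?_
  have h : Function.update (fun k => r k • x k) kl.1 (Pi.single kl.2 1) =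
      fun k => Function.update r kl.1 1 k • Function.update x kl.1 (Pi.single kl.2 1) k := by
    funext k
    rcases eq_or_ne k kl.1 with rfl | h <;> simp [*]
  rw [jacMat, jacMat, h, mForm_smul, Pi.smul_apply, smul_eq_mul,
    Finset.prod_update_of_mem (Finset.mem_univ _), one_mul,
    ← Finset.prod_sdiff (Finset.subset_univ {kl.1}), Finset.prod_singleton]
  ring

lemma jacMat_sum_smul {K ι : Type*} [CommSemiring K] {d n : ℕ} (s : Finset ι) (β : ι → K)
    (f : ι → MvPolynomial (Fin n) K) (x : Fin (d - 1) → Fin n → K) :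
    jacMat d n (∑ ρ ∈ s, β ρ • f ρ) x = ∑ ρ ∈ s, β ρ • jacMat d n (f ρ) x := by
  ext i kl
  simp [jacMat, mForm_sum_smul, Matrix.sum_apply]

lemma continuous_mForm {d n : ℕ} (p : MvPolynomial (Fin n) ℝ) :
    Continuous fun x : Fin (d - 1) → Fin n → ℝ => mForm d n p x := by
  unfold mForm
  fun_prop

lemma continuous_jacMat {d n : ℕ} (p : MvPolynomial (Fin n) ℝ) :
    Continuous fun x : Fin (d - 1) → Fin n → ℝ => jacMat d n p x := by
  refine continuous_matrix fun i kl => ?_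
  exact (continuous_apply i).comp
    ((continuous_mForm p).comp (continuous_id.update kl.1 continuous_const))

/-- A real matrix of complex rank at least `r` is injective on some coordinate subspace of
dimension `r`. -/
lemma Matrix.exists_finset_mulVec_injOn {ι κ : Type*} [Fintype ι] [Fintype κ]
    (A : Matrix ι κ ℝ) {r : ℕ} (hr : r ≤ (A.map (algebraMap ℝ ℂ)).rank) :
    ∃ T : Finset κ, T.card = r ∧
      ∀ u : κ → ℝ, (∀ p ∉ T, u p = 0) → A.mulVec u = 0 → u = 0 := by
  classical
  obtain ⟨κ', a, ha, hsp, hli⟩ := exists_linearIndependent' ℂ (A.map (algebraMap ℝ ℂ)).col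
  have := Fintype.ofInjective a ha
  have hcard : (Finset.univ.image a).card = (A.map (algebraMap ℝ ℂ)).rank := by
    rw [Finset.card_image_of_injective _ ha, Finset.card_univ, Matrix.rank_eq_finrank_span_cols,
      ← hsp, finrank_span_eq_card hli]
  obtain ⟨T, hT, hTr⟩ := Finset.exists_subset_card_eq (hr.trans_eq hcard.symm)
  refine ⟨T, hTr, fun u hu hAu => ?_⟩
  have hu' : ∀ p ∉ Finset.univ.image a, u p = 0 := fun p hp => hu p fun h => hp (hT h)
  have key := Fintype.linearIndependent_iff.1 hli (fun q => (u (a q) : ℂ)) <| by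
    funext i
    have h := congrFun hAu i
    rw [Matrix.mulVec, dotProduct, ← Finset.sum_subset (Finset.subset_univ (Finset.univ.image a))
      (fun p _ hp => by rw [hu' p hp, mul_zero]), Finset.sum_image ha.injOn] at h
    have h' := congrArg (fun t : ℝ => (t : ℂ)) h
    simpa [Finset.sum_apply, mul_comm] using h'
  funext p
  by_cases hp : p ∈ Finset.univ.image a
  · obtain ⟨q, -, rfl⟩ := Finset.mem_image.1 hp
    exact_mod_cast key q
  · exact hu' p hp

lemma le_rank_jacMat_of_mForm_eq_zero {d R n : ℕ} (hd : 1 ≤ d)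
    (f : Fin R → MvPolynomial (Fin n) ℝ) {β : Fin R → ℝ} (hβ : β ≠ 0)
    {x : Fin (d - 1) → Fin n → ℝ} (hx : ∀ k, x k ≠ 0)
    (hm : mForm d n (∑ ρ, β ρ • f ρ) x = 0) :
    n - sigmaStarR d n R (fun ρ => homogeneousComponent d (f ρ)) ≤
      ((jacMat d n (∑ ρ, β ρ • f ρ) x).map (algebraMap ℝ ℂ)).rank := by
  have hmap : (∑ ρ, ((β ρ : ℝ) : ℂ) • (homogeneousComponent d (f ρ)).map (algebraMap ℝ ℂ)) =
      (homogeneousComponent d (∑ ρ, β ρ • f ρ)).map (algebraMap ℝ ℂ) := by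
    simp [map_sum, smul_eq_C_mul]
  have hle : n - ((jacMat d n (∑ ρ, β ρ • f ρ) x).map (algebraMap ℝ ℂ)).rank ≤
      sigmaStarR d n R (fun ρ => homogeneousComponent d (f ρ)) := by
    refine le_csSup ⟨n, ?_⟩ ⟨fun ρ => (β ρ : ℂ), ?_, fun k l => algebraMap ℝ ℂ (x k l), ?_, ?_, ?_⟩
    · rintro s ⟨-, -, -, -, -, rfl⟩
      exact Nat.sub_le _ _
    · contrapose! hβ
      funext ρ
      exact Complex.ofReal_eq_zero.1 (congrFun hβ ρ)
    · intro k
      specialize hx k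
      contrapose! hx
      funext l
      simpa using congrFun hx l
    · rw [hmap]
      funext i
      rw [mForm_map, mForm_homogeneousComponent hd, hm]
      simp
    · rw [hmap, jacMat_map, jacMat_homogeneousComponent hd]
  omega

/-- Injectivity of a matrix on a coordinate subspace is an open condition, quantitatively. -/
lemma Matrix.eventually_mul_norm_le_norm_mulVec {X ι κ : Type*} [TopologicalSpace X] [Fintype ι]
    [Fintype κ] {A : X → Matrix ι κ ℝ} (hA : Continuous A) (p₀ : X) (T : Finset κ)
    (hT : ∀ u : κ → ℝ, (∀ q ∉ T, u q = 0) → (A p₀).mulVec u = 0 → u = 0) :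
    ∃ c : ℝ, 0 < c ∧ ∀ᶠ p in nhds p₀, ∀ u : κ → ℝ, (∀ q ∉ T, u q = 0) →
      c * ‖u‖ ≤ ‖(A p).mulVec u‖ := by
  set K : Set (κ → ℝ) := Metric.sphere 0 1 ∩ {u | ∀ q ∉ T, u q = 0} with hK
  have hKc : IsCompact K := by
    refine (isCompact_sphere 0 1).inter_right ?_
    simp only [Set.ofPred_forall]
    exact isClosed_iInter fun q => isClosed_iInter fun _ =>
      isClosed_eq (continuous_apply q) continuous_const
  have hφ : Continuous fun z : X × (κ → ℝ) => ‖(A z.1).mulVec z.2‖ :=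
    ((hA.comp continuous_fst).matrix_mulVec continuous_snd).norm
  obtain ⟨c, hc, hcK⟩ : ∃ c : ℝ, 0 < c ∧ ∀ u ∈ K, c < ‖(A p₀).mulVec u‖ := by
    refine hKc.exists_forall_le' (f := fun u => ‖(A p₀).mulVec u‖)
      (hφ.comp (Continuous.prodMk_right p₀)).continuousOn (a := 0) (fun u hu => ?_) |>.elim
      fun c hc => ⟨c / 2, half_pos hc.1, fun u hu => (half_lt_self hc.1).trans_le (hc.2 u hu)⟩
    refine norm_pos_iff.2 fun h => ?_
    have h1 : ‖u‖ = 1 := by simpa using hu.1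
    rw [hT u hu.2 h, norm_zero] at h1
    exact zero_ne_one h1
  refine ⟨c, hc, (hKc.eventually_forall_of_forall_eventually (x₀ := p₀)
    (P := fun p u => c < ‖(A p).mulVec u‖) fun u hu =>
      hφ.continuousAt.eventually (lt_mem_nhds (hcK u hu))).mono fun p hp u hu => ?_⟩
  rcases eq_or_ne u 0 with rfl | hu0
  · simp
  have hpos : 0 < ‖u‖ := norm_pos_iff.2 hu0
  have h := (hp (‖u‖⁻¹ • u) ⟨by simp [norm_smul, hpos.ne'], fun q hq => by simp [hu q hq]⟩).le
  rw [Matrix.mulVec_smul, norm_smul, norm_inv, norm_norm, inv_mul_eq_div, le_div_iff₀ hpos] at h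
  exact h

/-- On a compact set where a matrix has complex rank at least `r` at all zeros of a function `m`,
either `m` is bounded below, or the matrix is bounded below on some coordinate subspace of
dimension `r`. -/
lemma IsCompact.exists_pos_norm_le_or_mul_norm_le {X E ι κ : Type*} [TopologicalSpace X]
    [NormedAddCommGroup E] [Fintype ι] [Fintype κ] {K : Set X} (hK : IsCompact K)
    {m : X → E} (hm : Continuous m) {A : X → Matrix ι κ ℝ} (hA : Continuous A) {r : ℕ}
    (hr : ∀ p ∈ K, m p = 0 → r ≤ ((A p).map (algebraMap ℝ ℂ)).rank) :
    ∃ c : ℝ, 0 < c ∧ ∀ p ∈ K, c ≤ ‖m p‖ ∨ ∃ T : Finset κ, T.card = r ∧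
      ∀ u : κ → ℝ, (∀ q ∉ T, u q = 0) → c * ‖u‖ ≤ ‖(A p).mulVec u‖ := by
  have mono : ∀ {c c' : ℝ} {p : X}, c' ≤ c →
      (c ≤ ‖m p‖ ∨ ∃ T : Finset κ, T.card = r ∧
        ∀ u : κ → ℝ, (∀ q ∉ T, u q = 0) → c * ‖u‖ ≤ ‖(A p).mulVec u‖) →
      (c' ≤ ‖m p‖ ∨ ∃ T : Finset κ, T.card = r ∧
        ∀ u : κ → ℝ, (∀ q ∉ T, u q = 0) → c' * ‖u‖ ≤ ‖(A p).mulVec u‖) := by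
    rintro c c' p hc (h | ⟨T, hT, h⟩)
    · exact Or.inl (hc.trans h)
    · exact Or.inr ⟨T, hT, fun u hu =>
        (mul_le_mul_of_nonneg_right hc (norm_nonneg u)).trans (h u hu)⟩
  refine hK.induction_on (p := fun s => ∃ c : ℝ, 0 < c ∧ ∀ p ∈ s, c ≤ ‖m p‖ ∨
    ∃ T : Finset κ, T.card = r ∧ ∀ u : κ → ℝ, (∀ q ∉ T, u q = 0) →
      c * ‖u‖ ≤ ‖(A p).mulVec u‖) ⟨1, one_pos, by simp⟩ ?_ ?_ ?_
  · rintro s t hst ⟨c, hc, h⟩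
    exact ⟨c, hc, fun p hp => h p (hst hp)⟩
  · rintro s t ⟨c, hc, h⟩ ⟨c', hc', h'⟩
    refine ⟨min c c', lt_min hc hc', fun p hp => ?_⟩
    rcases hp with hp | hp
    · exact mono (min_le_left _ _) (h p hp)
    · exact mono (min_le_right _ _) (h' p hp)
  · intro p₀ hp₀
    by_cases h0 : m p₀ = 0
    · obtain ⟨T, hTr, hT⟩ := (A p₀).exists_finset_mulVec_injOn (hr p₀ hp₀ h0)
      obtain ⟨c, hc, h⟩ := Matrix.eventually_mul_norm_le_norm_mulVec hA p₀ T hT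
      exact ⟨_, mem_nhdsWithin_of_mem_nhds h, c, hc, fun p hp => Or.inr ⟨T, hTr, hp⟩⟩
    · have hpos : 0 < ‖m p₀‖ := norm_pos_iff.2 h0
      have h := hm.norm.continuousAt.eventually (lt_mem_nhds (half_lt_self hpos))
      exact ⟨_, mem_nhdsWithin_of_mem_nhds h, ‖m p₀‖ / 2, half_pos hpos,
        fun p hp => Or.inl (le_of_lt hp)⟩

lemma Finset.sum_card_filter_prodMk {ι κ : Type*} [Fintype ι] [Fintype κ] [DecidableEq ι]
    [DecidableEq κ] (T : Finset (ι × κ)) :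
    ∑ k, (Finset.univ.filter fun i => (k, i) ∈ T).card = T.card := by
  simp only [Finset.card_filter]
  rw [← Fintype.sum_prod_type' (fun k i => if (k, i) ∈ T then 1 else 0)]
  simp

/-- Either the multilinear system `m^{(β·f)}` is large at the
point, or there are coordinate subspaces `U_1,…,U_{d-1}` of total dimension
`n - σ*(F)` on which the Jacobian `J^{(β·f)}` acts in a suitably nondegenerate
way. -/
theorem statement4 (d R n : ℕ) (hd : 2 ≤ d) (hR : 1 ≤ R) (hn : 1 ≤ n)
    (f : Fin R → MvPolynomial (Fin n) ℝ)
    (hdeg : ∀ ρ, (f ρ).totalDegree = d) :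
    ∃ c : ℝ, 0 < c ∧ ∀ β : Fin R → ℝ, β ≠ 0 →
      ∀ x : Fin (d - 1) → Fin n → ℝ, (∀ k, x k ≠ 0) →
        ‖mForm d n (∑ ρ, β ρ • f ρ) x‖ ≥ c * ‖β‖ * ∏ k, ‖x k‖ ∨
        ∃ S : Fin (d - 1) → Finset (Fin n),
          (∑ k, (S k).card) =
            n - sigmaStarR d n R (fun ρ => MvPolynomial.homogeneousComponent d (f ρ)) ∧
          ∀ u : Fin (d - 1) → Fin n → ℝ, (∀ k, ∀ i ∉ S k, u k i = 0) →
            ‖(jacMat d n (∑ ρ, β ρ • f ρ) x).mulVec (fun kl => u kl.1 kl.2)‖ ≥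
              c * ‖β‖ * (∏ k, ‖x k‖) * ⨆ k, ‖u k‖ / ‖x k‖ := by
  have hd1 : 1 ≤ d := by omega
  have : Nonempty (Fin (d - 1)) := ⟨⟨0, by omega⟩⟩
  have hK : IsCompact (Metric.sphere (0 : Fin R → ℝ) 1 ×ˢ
      Set.pi Set.univ fun _ : Fin (d - 1) => Metric.sphere (0 : Fin n → ℝ) 1) :=
    (isCompact_sphere 0 1).prod (isCompact_univ_pi fun _ => isCompact_sphere 0 1)
  obtain ⟨c, hc, key⟩ := hK.exists_pos_norm_le_or_mul_norm_le
    (m := fun p => mForm d n (∑ ρ, p.1 ρ • f ρ) p.2)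
    (A := fun p => jacMat d n (∑ ρ, p.1 ρ • f ρ) p.2)
    (r := n - sigmaStarR d n R (fun ρ => MvPolynomial.homogeneousComponent d (f ρ)))
    (by
      simp only [mForm_sum_smul]
      exact continuous_finsetSum _ fun ρ _ => ((continuous_apply ρ).comp continuous_fst).smul
        ((continuous_mForm (f ρ)).comp continuous_snd))
    (by
      simp only [jacMat_sum_smul]
      exact continuous_finsetSum _ fun ρ _ => ((continuous_apply ρ).comp continuous_fst).smul
        ((continuous_jacMat (f ρ)).comp continuous_snd))
    (by
      rintro ⟨β, x⟩ ⟨hβ, hx⟩ hm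
      exact le_rank_jacMat_of_mForm_eq_zero hd1 f
        (ne_zero_of_mem_unit_sphere ⟨β, hβ⟩)
        (fun k => ne_zero_of_mem_unit_sphere ⟨x k, hx k trivial⟩) hm)
  refine ⟨c, hc, fun β hβ x hx => ?_⟩
  have hb : 0 < ‖β‖ := norm_pos_iff.2 hβ
  have hr : ∀ k, 0 < ‖x k‖ := fun k => norm_pos_iff.2 (hx k)
  have hP : 0 < ∏ k, ‖x k‖ := Finset.prod_pos fun k _ => hr k
  set y : Fin (d - 1) → Fin n → ℝ := fun k => ‖x k‖⁻¹ • x k with hy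
  set γ : Fin R → ℝ := ‖β‖⁻¹ • β with hγ
  have hxy : x = fun k => ‖x k‖ • y k := by
    funext k
    rw [hy, smul_inv_smul₀ (hr k).ne']
  have hβγ : ∀ ρ, β ρ = ‖β‖ * γ ρ := fun ρ => by
    rw [hγ, Pi.smul_apply, smul_eq_mul, mul_inv_cancel_left₀ hb.ne']
  have hmβ : ‖mForm d n (∑ ρ, β ρ • f ρ) x‖ =
      ‖β‖ * (∏ k, ‖x k‖) * ‖mForm d n (∑ ρ, γ ρ • f ρ) y‖ := by
    have h : mForm d n (∑ ρ, β ρ • f ρ) x =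
        ‖β‖ • (∏ k, ‖x k‖) • mForm d n (∑ ρ, γ ρ • f ρ) y := by
      rw [← mForm_smul, ← hxy, mForm_sum_smul, mForm_sum_smul, Finset.smul_sum]
      simp only [smul_smul, ← hβγ]
    rw [h, norm_smul, norm_smul, norm_norm, Real.norm_of_nonneg hP.le, mul_assoc]
  rcases key (γ, y) ⟨by simp [hγ, norm_smul, hb.ne'],
    fun k _ => by simp [hy, norm_smul, (hr k).ne']⟩ with h | ⟨T, hT, h⟩
  · left
    rw [hmβ, ge_iff_le, mul_assoc, mul_comm c]
    exact mul_le_mul_of_nonneg_left h (by positivity)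
  · right
    refine ⟨fun k => Finset.univ.filter fun i => (k, i) ∈ T,
      (Finset.sum_card_filter_prodMk T).trans hT, fun u hu => ?_⟩
    set v : Fin (d - 1) → Fin n → ℝ := fun k => ‖x k‖⁻¹ • u k with hv
    have hJ : (jacMat d n (∑ ρ, β ρ • f ρ) x).mulVec (fun kl => u kl.1 kl.2) =
        ‖β‖ • (∏ k, ‖x k‖) •
          (jacMat d n (∑ ρ, γ ρ • f ρ) y).mulVec (fun kl => v kl.1 kl.2) := by
      have huv : (fun kl : Fin (d - 1) × Fin n => u kl.1 kl.2) =
          fun kl => ‖x kl.1‖ * v kl.1 kl.2 := by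
        funext kl
        simp only [hv, Pi.smul_apply, smul_eq_mul, mul_inv_cancel_left₀ (hr kl.1).ne']
      rw [← jacMat_smul_mulVec, ← hxy, ← huv, ← Matrix.smul_mulVec, jacMat_sum_smul,
        jacMat_sum_smul, Finset.smul_sum]
      simp only [smul_smul, ← hβγ]
    have hsup : ⨆ k, ‖u k‖ / ‖x k‖ ≤ ‖fun kl : Fin (d - 1) × Fin n => v kl.1 kl.2‖ := by
      refine ciSup_le fun k => ?_
      have hvk : ‖u k‖ / ‖x k‖ = ‖v k‖ := by
        rw [hv, norm_smul, norm_inv, norm_norm, div_eq_inv_mul]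
      rw [hvk]
      exact (pi_norm_le_iff_of_nonneg (norm_nonneg _)).2 fun i =>
        norm_le_pi_norm (fun kl : Fin (d - 1) × Fin n => v kl.1 kl.2) (k, i)
    rw [hJ, norm_smul, norm_smul, norm_norm, Real.norm_of_nonneg hP.le, ge_iff_le]
    calc c * ‖β‖ * (∏ k, ‖x k‖) * ⨆ k, ‖u k‖ / ‖x k‖
        ≤ c * ‖β‖ * (∏ k, ‖x k‖) * ‖fun kl : Fin (d - 1) × Fin n => v kl.1 kl.2‖ :=
          mul_le_mul_of_nonneg_left hsup (by positivity)
      _ = ‖β‖ * ((∏ k, ‖x k‖) * (c * ‖fun kl : Fin (d - 1) × Fin n => v kl.1 kl.2‖)) := by ring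
      _ ≤ _ := by
          gcongr
          refine h _ fun q hq => ?_
          simp [hv, hu q.1 q.2 (by simpa using hq)]
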